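/- arXiv:1807.07222 — 4 statements merged into one kernel-verified Lean document; each statement's English description precedes it below -/
import Mathlib

section
/- With Σ̄_S and f as defined, it holds that f(∅) = 0, and for every S ⊆ {1,…,N} and every j ∈ {1,…,N} \ S, the marginal gain satisfies f(S ∪ {j}) − f(S) = (u_jᵀ Σ̄_S² u_j) / (σ_j² + u_jᵀ Σ̄_S u_j). In particular, if u_j ≠ 0 then f(S ∪ {j}) > f(S), so f is a monotonically increasing set function. -/
open Matrix

/-- The error covariance matrix `Σ̄_S = (P⁻¹ + ∑_{j∈S} σ_j⁻² u_j u_jᵀ)⁻¹`. -/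
noncomputable def errCov {k N : ℕ} (P : Matrix (Fin k) (Fin k) ℝ) (u : Fin N → Fin k → ℝ)
    (σ : Fin N → ℝ) (S : Finset (Fin N)) : Matrix (Fin k) (Fin k) ℝ :=
  (P⁻¹ + ∑ j ∈ S, ((σ j) ^ 2)⁻¹ • vecMulVec (u j) (u j))⁻¹

/-- The set function `f(S) = Tr(P − Σ̄_S)`. -/
noncomputable def fMSE {k N : ℕ} (P : Matrix (Fin k) (Fin k) ℝ) (u : Fin N → Fin k → ℝ)
    (σ : Fin N → ℝ) (S : Finset (Fin N)) : ℝ :=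
  (P - errCov P u σ S).trace

/-- The **Sherman–Morrison formula** for a rescaled rank-one update. -/
theorem Matrix.inv_add_inv_smul_vecMulVec {n K : Type*} [Fintype n] [DecidableEq n] [Field K]
    {A : Matrix n n K} (hA : IsUnit A) (u v : n → K) {c : K} (hc : c ≠ 0)
    (hd : c + v ⬝ᵥ A⁻¹ *ᵥ u ≠ 0) :
    (A + c⁻¹ • vecMulVec u v)⁻¹ =
      A⁻¹ - (c + v ⬝ᵥ A⁻¹ *ᵥ u)⁻¹ • vecMulVec (A⁻¹ *ᵥ u) (v ᵥ* A⁻¹) := by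
  have hdet : IsUnit A.det := (isUnit_iff_isUnit_det A).mp hA
  apply inv_eq_right_inv
  have hcoef : c⁻¹ - (c + v ⬝ᵥ A⁻¹ *ᵥ u)⁻¹ -
      c⁻¹ * ((c + v ⬝ᵥ A⁻¹ *ᵥ u)⁻¹ * (v ⬝ᵥ A⁻¹ *ᵥ u)) = 0 := by
    field_simp
    ring
  generalize (c + v ⬝ᵥ A⁻¹ *ᵥ u)⁻¹ = e at hcoef ⊢
  have hAu : A *ᵥ (A⁻¹ *ᵥ u) = u := by
    rw [mulVec_mulVec, mul_nonsing_inv A hdet, one_mulVec]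
  rw [add_mul, mul_sub, mul_sub, mul_nonsing_inv A hdet, mul_smul_comm, mul_vecMulVec, hAu,
    smul_mul_assoc, vecMulVec_mul, smul_mul_assoc, mul_smul_comm, vecMulVec_mul_vecMulVec,
    vecMulVec_smul]
  calc
    _ = 1 + (c⁻¹ - e - c⁻¹ * (e * (v ⬝ᵥ A⁻¹ *ᵥ u))) • vecMulVec u (v ᵥ* A⁻¹) := by module
    _ = 1 := by rw [hcoef, zero_smul, add_zero]

theorem posDef_inv_add_sum_smul_vecMulVec {k N : ℕ} {P : Matrix (Fin k) (Fin k) ℝ}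
    (hP : P.PosDef) (u : Fin N → Fin k → ℝ) (σ : Fin N → ℝ) (S : Finset (Fin N)) :
    (P⁻¹ + ∑ j ∈ S, ((σ j) ^ 2)⁻¹ • vecMulVec (u j) (u j)).PosDef := by
  refine hP.inv.add_posSemidef (posSemidef_sum S fun j _ => ?_)
  have h := posSemidef_vecMulVec_self_star (u j)
  rw [star_trivial] at h
  exact h.smul (by positivity)

theorem errCov_posDef {k N : ℕ} {P : Matrix (Fin k) (Fin k) ℝ} (hP : P.PosDef)
    (u : Fin N → Fin k → ℝ) (σ : Fin N → ℝ) (S : Finset (Fin N)) :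
    (errCov P u σ S).PosDef :=
  (posDef_inv_add_sum_smul_vecMulVec hP u σ S).inv

theorem sq_add_dotProduct_errCov_mulVec_pos {k N : ℕ} {P : Matrix (Fin k) (Fin k) ℝ}
    (hP : P.PosDef) (u : Fin N → Fin k → ℝ) {σ : Fin N → ℝ} (S : Finset (Fin N)) {j : Fin N}
    (hσ : 0 < σ j) : 0 < (σ j) ^ 2 + u j ⬝ᵥ (errCov P u σ S) *ᵥ (u j) := by
  have h := (errCov_posDef hP u σ S).posSemidef.dotProduct_mulVec_nonneg (u j)
  rw [star_trivial] at h
  positivity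

theorem errCov_insert {k N : ℕ} {P : Matrix (Fin k) (Fin k) ℝ} (hP : P.PosDef)
    (u : Fin N → Fin k → ℝ) {σ : Fin N → ℝ} {S : Finset (Fin N)} {j : Fin N} (hj : j ∉ S)
    (hσ : 0 < σ j) :
    errCov P u σ (insert j S) = errCov P u σ S -
      ((σ j) ^ 2 + u j ⬝ᵥ (errCov P u σ S) *ᵥ (u j))⁻¹ •
        vecMulVec (errCov P u σ S *ᵥ u j) (u j ᵥ* errCov P u σ S) := by
  have h := inv_add_inv_smul_vecMulVec (posDef_inv_add_sum_smul_vecMulVec hP u σ S).isUnit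
    (u j) (u j) (pow_pos hσ 2).ne' (sq_add_dotProduct_errCov_mulVec_pos hP u S hσ).ne'
  rw [errCov, Finset.sum_insert hj, add_comm (_ • _), ← add_assoc]
  exact h

theorem fMSE_empty {k N : ℕ} {P : Matrix (Fin k) (Fin k) ℝ} (hP : P.PosDef)
    (u : Fin N → Fin k → ℝ) (σ : Fin N → ℝ) : fMSE P u σ ∅ = 0 := by
  have hdet : IsUnit P.det := (isUnit_iff_isUnit_det P).mp hP.isUnit
  simp [fMSE, errCov, nonsing_inv_nonsing_inv P hdet]

theorem fMSE_insert_sub {k N : ℕ} {P : Matrix (Fin k) (Fin k) ℝ} (hP : P.PosDef)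
    (u : Fin N → Fin k → ℝ) {σ : Fin N → ℝ} {S : Finset (Fin N)} {j : Fin N} (hj : j ∉ S)
    (hσ : 0 < σ j) :
    fMSE P u σ (insert j S) - fMSE P u σ S =
      (u j ⬝ᵥ (errCov P u σ S * errCov P u σ S) *ᵥ (u j)) /
        ((σ j) ^ 2 + u j ⬝ᵥ (errCov P u σ S) *ᵥ (u j)) := by
  have h : (vecMulVec (errCov P u σ S *ᵥ u j) (u j ᵥ* errCov P u σ S)).trace =
      u j ⬝ᵥ (errCov P u σ S * errCov P u σ S) *ᵥ (u j) := by
    rw [trace_vecMulVec, dotProduct_comm, ← dotProduct_mulVec, mulVec_mulVec]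
  rw [fMSE, fMSE, errCov_insert hP u hj hσ, trace_sub, trace_sub, trace_sub, trace_smul, h,
    smul_eq_mul, div_eq_inv_mul]
  ring

theorem Matrix.PosDef.dotProduct_mul_self_mulVec_pos {n : Type*} [Fintype n] [DecidableEq n]
    {A : Matrix n n ℝ} (hA : A.PosDef) {x : n → ℝ} (hx : x ≠ 0) :
    0 < x ⬝ᵥ (A * A) *ᵥ x := by
  have hAA : (A * A).PosDef := by
    have h := PosDef.conjTranspose_mul_self A (mulVec_injective_of_isUnit hA.isUnit)
    rwa [hA.isHermitian.eq] at h
  have h := hAA.dotProduct_mulVec_pos hx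
  rwa [star_trivial] at h

/-- **Proposition 2.** `f(∅) = 0`; for every `S` and `j ∉ S` the marginal gain is
`f(S ∪ {j}) − f(S) = (u_jᵀ Σ̄_S² u_j) / (σ_j² + u_jᵀ Σ̄_S u_j)`; and if `u_j ≠ 0` this gain is
positive, so `f` is monotonically increasing. -/
theorem stmt5 {k N : ℕ} (P : Matrix (Fin k) (Fin k) ℝ) (hP : P.PosDef)
    (u : Fin N → Fin k → ℝ) (σ : Fin N → ℝ) (hσ : ∀ j, 0 < σ j) :
    fMSE P u σ ∅ = 0 ∧
    ∀ S : Finset (Fin N), ∀ j ∉ S,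
      fMSE P u σ (insert j S) - fMSE P u σ S =
        (u j ⬝ᵥ (errCov P u σ S * errCov P u σ S).mulVec (u j)) /
          ((σ j) ^ 2 + u j ⬝ᵥ (errCov P u σ S).mulVec (u j)) ∧
      (u j ≠ 0 → fMSE P u σ S < fMSE P u σ (insert j S)) := by
  refine ⟨fMSE_empty hP u σ, fun S j hj => ?_⟩
  have hgain := fMSE_insert_sub hP u hj (hσ j)
  refine ⟨hgain, fun hu => ?_⟩
  rw [← sub_pos, hgain]
  exact div_pos ((errCov_posDef hP u σ S).dotProduct_mul_self_mulVec_pos hu)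
    (sq_add_dotProduct_errCov_mulVec_pos hP u S (hσ j))
end

section
/- Let X be a finite ground set, f : 2^X → ℝ a monotone nondecreasing set function, and C_f > 0 an upper bound on the maximum element-wise curvature of f. Let S ⊂ T ⊆ X with r := |T \ S| ≥ 1. Then f(T) − f(S) ≤ C(r) · Σ_{j ∈ T\S} f_j(S), where C(r) = (1/r)(1 + (r−1) C_f). -/
/-- Under the curvature bound, adding a set `D` disjoint from `A` gains at most `Cf` times the sum
of the marginal gains of its elements at a subset `S` of `A`. -/
theorem sub_le_mul_sum_of_curvature {α : Type*} [DecidableEq α] {f : Finset α → ℝ} {Cf : ℝ}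
    (hcurv : ∀ (S T : Finset α) (i : α), S ⊆ T → i ∉ T →
      f (insert i T) - f T ≤ Cf * (f (insert i S) - f S))
    {S A D : Finset α} (hSA : S ⊆ A) (hAD : Disjoint A D) :
    f (A ∪ D) - f A ≤ Cf * ∑ i ∈ D, (f (insert i S) - f S) := by
  induction D using Finset.induction_on with
  | empty => simp
  | insert i D hi ih =>
    rw [Finset.disjoint_insert_right] at hAD
    have hgain := hcurv S (A ∪ D) i (hSA.trans Finset.subset_union_left) (by simp [hAD.1, hi])
    rw [Finset.sum_insert hi, Finset.union_insert, mul_add]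
    linarith [ih hAD.2]

/-- **Lemma 1.** If `f` is monotone nondecreasing and `C_f > 0` upper-bounds its
maximum element-wise curvature (`f_i(T) ≤ C_f f_i(S)` whenever `S ⊆ T`, `i ∉ T`), then for any
`S ⊂ T` with `r = |T \ S| ≥ 1`,
`f(T) − f(S) ≤ (1/r)(1 + (r−1)C_f) ∑_{j ∈ T\S} f_j(S)`. -/
theorem stmt7 {α : Type*} [Fintype α] [DecidableEq α] (f : Finset α → ℝ)
    (hmono : ∀ S T : Finset α, S ⊆ T → f S ≤ f T)
    (Cf : ℝ) (hCf : 0 < Cf)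
    (hcurv : ∀ (S T : Finset α) (i : α), S ⊆ T → i ∉ T →
      f (insert i T) - f T ≤ Cf * (f (insert i S) - f S))
    (S T : Finset α) (hST : S ⊆ T) (hr : 1 ≤ (T \ S).card) :
    f T - f S ≤
      ((1 + (((T \ S).card : ℝ) - 1) * Cf) / ((T \ S).card : ℝ)) *
        ∑ j ∈ T \ S, (f (insert j S) - f S) := by
  set D := T \ S with hD
  set g : α → ℝ := fun j ↦ f (insert j S) - f S with hg
  have hbound : ∀ j ∈ D, f T - f S ≤ g j + Cf * (∑ i ∈ D, g i - g j) := by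
    intro j hj
    have hdisj : Disjoint (insert j S) (D.erase j) := by
      rw [Finset.disjoint_insert_left]
      exact ⟨Finset.notMem_erase j D,
        Finset.disjoint_sdiff.mono_right (Finset.erase_subset j D)⟩
    have hunion : insert j S ∪ D.erase j = T := by
      rw [Finset.insert_union, ← Finset.union_insert, Finset.insert_erase hj, hD,
        Finset.union_sdiff_of_subset hST]
    have hgain := sub_le_mul_sum_of_curvature hcurv (Finset.subset_insert j S) hdisj
    rw [hunion, Finset.sum_erase_eq_sub (f := g) hj] at hgain
    simp only [hg] at hgain ⊢
    linarith
  clear_value g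
  have hsum := Finset.sum_le_sum hbound
  rw [Finset.sum_const, nsmul_eq_mul, Finset.sum_add_distrib, ← Finset.mul_sum,
    Finset.sum_sub_distrib, Finset.sum_const, nsmul_eq_mul] at hsum
  have hpos : (0 : ℝ) < D.card := by exact_mod_cast hr
  rw [div_mul_eq_mul_div, le_div_iff₀ hpos]
  linarith
end

section
/- Let m ≥ 1 be an integer, c ≥ 1 a real number, and t ∈ [0,1). Then 1 − (1 − (1−t)/(mc))^m ≥ 1 − e^{−1/c} − t/c. Consequently, if a_m ≥ (1 − (1 − (1−t)/(mc))^m) F for some F ≥ 0, then a_m ≥ (1 − e^{−1/c} − t/c) F. -/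
/-- **approximation factor of Theorem 2.** For an integer `m ≥ 1`, `c ≥ 1`, and
`t ∈ [0,1)`: `1 − (1 − (1−t)/(mc))^m ≥ 1 − e^{−1/c} − t/c`; consequently, if
`a_m ≥ (1 − (1 − (1−t)/(mc))^m) F` with `F ≥ 0`, then `a_m ≥ (1 − e^{−1/c} − t/c) F`. -/
theorem stmt12 (m : ℕ) (hm : 1 ≤ m) (c t : ℝ) (hc : 1 ≤ c) (ht0 : 0 ≤ t) (ht1 : t < 1) :
    (1 - Real.exp (-1 / c) - t / c ≤ 1 - (1 - (1 - t) / (m * c)) ^ m) ∧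
    (∀ F am : ℝ, 0 ≤ F → (1 - (1 - (1 - t) / (m * c)) ^ m) * F ≤ am →
      (1 - Real.exp (-1 / c) - t / c) * F ≤ am) := by
  have hc0 : 0 < c := by linarith
  have hx0 : 0 ≤ (1 - t) / c := div_nonneg (by linarith) hc0.le
  have hx1 : (1 - t) / c ≤ 1 := (div_le_one hc0).2 (by linarith)
  have hm' : (1 : ℝ) ≤ m := by exact_mod_cast hm
  have hpow : (1 - (1 - t) / (m * c)) ^ m ≤ Real.exp (-((1 - t) / c)) := by
    rw [mul_comm, ← div_div]
    exact Real.one_sub_div_pow_le_exp_neg (hx1.trans hm')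
  have hexp : Real.exp (-((1 - t) / c)) ≤ Real.exp (-1 / c) + t / c := by
    have hsplit : Real.exp (-1 / c) = Real.exp (-((1 - t) / c)) * Real.exp (-(t / c)) := by
      rw [← Real.exp_add]
      congr 1
      ring
    have hle : Real.exp (-((1 - t) / c)) ≤ 1 := Real.exp_le_one_iff.2 (by linarith)
    have hlow : 1 - t / c ≤ Real.exp (-(t / c)) := Real.one_sub_le_exp_neg _
    have htc : 0 ≤ t / c := div_nonneg ht0 hc0.le
    rw [hsplit]
    nlinarith [Real.exp_pos (-((1 - t) / c))]
  have hmain : 1 - Real.exp (-1 / c) - t / c ≤ 1 - (1 - (1 - t) / (m * c)) ^ m := by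
    linarith
  exact ⟨hmain, fun F am hF h => (mul_le_mul_of_nonneg_right hmain hF).trans h⟩
end

section
/- Let m ≥ 1 be an integer, c ≥ 1 a real number, F ≥ 0, and η_1, …, η_m ∈ [0,1]. Let (a_i)_{i=0}^{m} be real numbers with a_0 = 0 and a_i ≥ a_{i−1} + (η_i/(mc)) (F − a_{i−1}) for all 1 ≤ i ≤ m. Then a_m ≥ (1 − ∏_{i=1}^{m} (1 − η_i/(mc))) F ≥ (1 − e^{−(Σ_{i=1}^{m} η_i)/(mc)}) F. -/
/-- A discrete Grönwall inequality for the gap `F - a n`. -/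
theorem sub_le_prod_one_sub_mul {F : ℝ} {t a : ℕ → ℝ} (n : ℕ)
    (ht : ∀ i, 1 ≤ i → i ≤ n → t i ≤ 1)
    (hrec : ∀ i, 1 ≤ i → i ≤ n → a (i - 1) + t i * (F - a (i - 1)) ≤ a i) :
    F - a n ≤ (∏ i ∈ Finset.Icc 1 n, (1 - t i)) * (F - a 0) := by
  induction n with
  | zero => simp
  | succ k ih =>
    have hk := ih (fun i h₁ h₂ => ht i h₁ (by lia)) (fun i h₁ h₂ => hrec i h₁ (by lia))
    have hstep := hrec (k + 1) (by lia) le_rfl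
    rw [Nat.add_sub_cancel] at hstep
    have hmul := mul_le_mul_of_nonneg_left hk (sub_nonneg.2 (ht (k + 1) (by lia) le_rfl))
    rw [Finset.prod_Icc_succ_top (by lia)]
    linarith

theorem prod_one_sub_le_exp_neg_sum {ι : Type*} (s : Finset ι) {t : ι → ℝ}
    (ht : ∀ i ∈ s, t i ≤ 1) :
    ∏ i ∈ s, (1 - t i) ≤ Real.exp (-∑ i ∈ s, t i) := by
  rw [← Finset.sum_neg_distrib, Real.exp_sum]
  exact Finset.prod_le_prod (fun i hi => sub_nonneg.2 (ht i hi))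
    fun i _ => Real.one_sub_le_exp_neg (t i)

/-- **deterministic core of Theorem 3.** If `a_0 = 0` and
`a_i ≥ a_{i−1} + (η_i/(mc))(F − a_{i−1})` for `1 ≤ i ≤ m`, with `η_i ∈ [0,1]`, `c ≥ 1`,
`F ≥ 0`, then `a_m ≥ (1 − ∏_{i=1}^m (1 − η_i/(mc))) F ≥ (1 − e^{−(∑_i η_i)/(mc)}) F`. -/
theorem stmt13 (m : ℕ) (hm : 1 ≤ m) (c F : ℝ) (hc : 1 ≤ c) (hF : 0 ≤ F)
    (η : ℕ → ℝ) (hη : ∀ i, 1 ≤ i → i ≤ m → 0 ≤ η i ∧ η i ≤ 1)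
    (a : ℕ → ℝ) (ha0 : a 0 = 0)
    (hrec : ∀ i, 1 ≤ i → i ≤ m → a (i - 1) + (η i / (m * c)) * (F - a (i - 1)) ≤ a i) :
    (1 - ∏ i ∈ Finset.Icc 1 m, (1 - η i / (m * c))) * F ≤ a m ∧
    (1 - Real.exp (-(∑ i ∈ Finset.Icc 1 m, η i) / (m * c))) * F ≤
      (1 - ∏ i ∈ Finset.Icc 1 m, (1 - η i / (m * c))) * F := by
  have hmc : 1 ≤ (m : ℝ) * c := one_le_mul_of_one_le_of_one_le (by exact_mod_cast hm) hc
  have ht : ∀ i, 1 ≤ i → i ≤ m → η i / (m * c) ≤ 1 := fun i h₁ h₂ =>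
    div_le_one_of_le₀ ((hη i h₁ h₂).2.trans hmc) (by linarith)
  constructor
  · have h := sub_le_prod_one_sub_mul m ht hrec
    rw [ha0] at h
    linarith
  · rw [neg_div, Finset.sum_div]
    refine mul_le_mul_of_nonneg_right (sub_le_sub_left ?_ 1) hF
    refine prod_one_sub_le_exp_neg_sum _ fun i hi => ?_
    exact ht i (Finset.mem_Icc.1 hi).1 (Finset.mem_Icc.1 hi).2
end
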